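/- Let G be a finite simple graph with no triangle adjacent to a 4-cycle, with no difficult components (λ(G) = 0), and with |E(G)| ≤ (15/7)·(|V(G)| − 2). Then α(G) ≥ (30/119)·|V(G)|; equivalently, the independence ratio |V(G)|/α(G) is at most 4 − 1/30. -/

import Mathlib

namespace Paper

/-- `s` is an independent set in the simple graph `G`. -/
def IsIndepSet {V : Type} (G : SimpleGraph V) (s : Finset V) : Prop :=
  ∀ v ∈ s, ∀ w ∈ s, ¬ G.Adj v w

/-- The independence number `α(G)`: the size of a largest independent set. -/
noncomputable def indepNum {V : Type} (G : SimpleGraph V) : ℕ :=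
  sSup {n | ∃ s : Finset V, IsIndepSet G s ∧ s.card = n}

/-- The number of edges `|E(G)|`. -/
noncomputable def numEdges {V : Type} (G : SimpleGraph V) : ℕ :=
  Nat.card G.edgeSet

/-- The degree of a vertex. -/
noncomputable def deg {V : Type} (G : SimpleGraph V) (v : V) : ℕ :=
  Nat.card (G.neighborSet v)

/-- `G` contains a triangle sharing a common edge with a 4-cycle:
the triangle `u v w` and the 4-cycle `u v x y` share the edge `u v`. -/
def HasTriangleAdjC4 {V : Type} (G : SimpleGraph V) : Prop :=
  ∃ u v w x y : V, G.Adj u v ∧ G.Adj v w ∧ G.Adj w u ∧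
    G.Adj v x ∧ G.Adj x y ∧ G.Adj y u ∧ u ≠ x ∧ v ≠ y

/-- `G` contains two triangles sharing a common edge:
the triangles `u v w` and `u v x` share the edge `u v`. -/
def HasAdjTriangles {V : Type} (G : SimpleGraph V) : Prop :=
  ∃ u v w x : V, G.Adj u v ∧ G.Adj v w ∧ G.Adj w u ∧
    G.Adj v x ∧ G.Adj x u ∧ w ≠ x

/-- `G` contains a triangle sharing a common edge with a 5-cycle:
the triangle `u v w` and the 5-cycle `u v x y z` share the edge `u v`. -/
def HasTriangleAdjC5 {V : Type} (G : SimpleGraph V) : Prop :=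
  ∃ u v w x y z : V, G.Adj u v ∧ G.Adj v w ∧ G.Adj w u ∧
    G.Adj v x ∧ G.Adj x y ∧ G.Adj y z ∧ G.Adj z u ∧
    u ≠ x ∧ u ≠ y ∧ v ≠ y ∧ v ≠ z ∧ x ≠ z

/-- The 2-chain of triangles: two disjoint triangles `{0,1,2}` and `{3,4,5}`
joined by the single edge `{2,3}` (6 vertices, 7 edges). -/
def chainGraph : SimpleGraph (Fin 6) :=
  SimpleGraph.fromRel (fun i j =>
    (i.val, j.val) ∈ [(0,1), (0,2), (1,2), (3,4), (3,5), (4,5), (2,3)])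

/-- A connected component is difficult if it is a triangle or a 2-chain of triangles. -/
def IsDifficult {V : Type} (G : SimpleGraph V) (c : G.ConnectedComponent) : Prop :=
  Nonempty (SimpleGraph.induce c.supp G ≃g (⊤ : SimpleGraph (Fin 3))) ∨
  Nonempty (SimpleGraph.induce c.supp G ≃g chainGraph)

/-- `λ(G)`: the number of difficult components of `G`. -/
noncomputable def lambda {V : Type} (G : SimpleGraph V) : ℕ :=
  Nat.card {c : G.ConnectedComponent // IsDifficult G c}

/-- `Φ(S)`: the number of edges of `G` with exactly one endpoint in `S`. -/
noncomputable def phi {V : Type} (G : SimpleGraph V) (S : Set V) : ℕ :=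
  Nat.card {e : Sym2 V | e ∈ G.edgeSet ∧ ∃ x ∈ S, ∃ y, y ∉ S ∧ e = s(x, y)}

section Counting

variable {V : Type} (G : SimpleGraph V) [DecidableRel G.Adj]

/-- The neighbours of `x` inside `A`. -/
def nbrs (A : Finset V) (x : V) : Finset V := A.filter (G.Adj x)

/-- The number of neighbours of `x` inside `A`. -/
def degIn (A : Finset V) (x : V) : ℕ := (nbrs G A x).card

/-- The number of ordered adjacent pairs in `A × B`; `cross G A A` is twice the number of edges
induced by `A`. -/
def cross (A B : Finset V) : ℕ := ∑ x ∈ A, degIn G B x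

variable {G}

lemma mem_nbrs {A : Finset V} {x y : V} : y ∈ nbrs G A x ↔ y ∈ A ∧ G.Adj x y := by
  simp [nbrs]

lemma nbrs_subset (A : Finset V) (x : V) : nbrs G A x ⊆ A := Finset.filter_subset _ _

lemma degIn_eq_sum (A : Finset V) (x : V) :
    degIn G A x = ∑ y ∈ A, if G.Adj x y then 1 else 0 := by
  simp [degIn, nbrs]

lemma cross_comm (A B : Finset V) : cross G A B = cross G B A := by
  simp only [cross, degIn_eq_sum]
  rw [Finset.sum_comm]
  simp only [G.adj_comm]

variable [DecidableEq V]

lemma degIn_sdiff_add {S W : Finset V} (h : S ⊆ W) (x : V) :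
    degIn G (W \ S) x + degIn G S x = degIn G W x := by
  simp only [degIn_eq_sum, Finset.sum_sdiff h]

lemma cross_add_cross_sdiff {S W : Finset V} (h : S ⊆ W) :
    cross G S S + cross G S (W \ S) = ∑ x ∈ S, degIn G W x := by
  simp only [cross, ← Finset.sum_add_distrib]
  refine Finset.sum_congr rfl fun x _ => ?_
  rw [← degIn_sdiff_add h, add_comm]

lemma cross_self_eq {S W : Finset V} (h : S ⊆ W) :
    cross G W W = cross G S S + 2 * cross G S (W \ S) + cross G (W \ S) (W \ S) := by
  have h1 : cross G W W = ∑ x ∈ S, degIn G W x + ∑ x ∈ W \ S, degIn G W x := by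
    rw [add_comm]; exact (Finset.sum_sdiff h).symm
  have h2 : ∑ x ∈ W \ S, degIn G W x = cross G (W \ S) (W \ S) + cross G (W \ S) S := by
    simp only [cross, ← Finset.sum_add_distrib, degIn_sdiff_add h]
  rw [h1, h2, ← cross_add_cross_sdiff h, cross_comm (W \ S) S]
  ring

lemma sum_cross_le {F : Finset (Finset V)} {S U : Finset V} (hF : ∀ C ∈ F, C ⊆ U)
    (hd : (F : Set (Finset V)).PairwiseDisjoint id) :
    ∑ C ∈ F, cross G C S ≤ cross G S U := by
  rw [cross_comm S U]
  have h := Finset.sum_biUnion (f := fun x => degIn G S x) hd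
  simp only [id] at h
  unfold cross
  rw [← h]
  exact Finset.sum_le_sum_of_subset (Finset.biUnion_subset.2 hF)

end Counting

section Components

variable {V : Type} (G : SimpleGraph V) {k l : ℕ}

/-- `C` is the vertex set of a component of `G[W]` isomorphic to the graph `H`
(which will always be connected). -/
def IsCompOf (H : SimpleGraph (Fin k)) (W C : Finset V) : Prop :=
  C ⊆ W ∧ (∃ φ : H ↪g G, C = Finset.univ.map φ.toEmbedding) ∧
    ∀ x ∈ C, ∀ y ∈ W, G.Adj x y → y ∈ C

open Classical in
/-- The components of `G[W]` isomorphic to `H`. -/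
noncomputable def comps (H : SimpleGraph (Fin k)) (W : Finset V) : Finset (Finset V) :=
  W.powerset.filter (IsCompOf G H W)

open Classical in
/-- The components of `G[W \ S]` isomorphic to `H` that are not components of `G[W]`. -/
noncomputable def newComps (H : SimpleGraph (Fin k)) (W S : Finset V) : Finset (Finset V) :=
  comps G H (W \ S) \ comps G H W

/-- The weighted number of difficult components of `G[W]`: triangles count twice. -/
noncomputable def cost (W : Finset V) : ℕ :=
  2 * (comps G (⊤ : SimpleGraph (Fin 3)) W).card + (comps G chainGraph W).card

variable {G}

lemma mem_comps {H : SimpleGraph (Fin k)} {W C : Finset V} :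
    C ∈ comps G H W ↔ IsCompOf G H W C := by
  simp only [comps, Finset.mem_filter, Finset.mem_powerset, and_iff_right_iff_imp]
  exact fun h => h.1

lemma mem_newComps [DecidableEq V] {H : SimpleGraph (Fin k)} {W S C : Finset V} :
    C ∈ newComps G H W S ↔ IsCompOf G H (W \ S) C ∧ ¬ IsCompOf G H W C := by
  simp only [newComps, Finset.mem_sdiff, mem_comps]
  convert Iff.rfl

lemma IsCompOf.subset_of_mem {H : SimpleGraph (Fin k)} (hH : H.Preconnected) {W C D : Finset V}
    (hC : IsCompOf G H W C) (hD : ∀ x ∈ D, ∀ y ∈ W, G.Adj x y → y ∈ D)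
    {x : V} (hxC : x ∈ C) (hxD : x ∈ D) : C ⊆ D := by
  obtain ⟨hCW, ⟨φ, rfl⟩, -⟩ := hC
  obtain ⟨i, -, rfl⟩ := Finset.mem_map.1 hxC
  intro y hy
  obtain ⟨j, -, rfl⟩ := Finset.mem_map.1 hy
  obtain ⟨p⟩ := hH i j
  induction p with
  | nil => exact hxD
  | @cons u v w huv p ih =>
    have hv : φ.toEmbedding v ∈ Finset.univ.map φ.toEmbedding := by simp
    exact ih (hD _ hxD _ (hCW hv) (φ.map_rel_iff.2 huv)) hv hy

lemma IsCompOf.eq_of_mem {H : SimpleGraph (Fin k)} {K : SimpleGraph (Fin l)}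
    (hH : H.Preconnected) (hK : K.Preconnected) {W C D : Finset V}
    (hC : IsCompOf G H W C) (hD : IsCompOf G K W D)
    {x : V} (hxC : x ∈ C) (hxD : x ∈ D) : C = D :=
  (hC.subset_of_mem hH hD.2.2 hxC hxD).antisymm (hD.subset_of_mem hK hC.2.2 hxD hxC)

lemma IsCompOf.card_eq {H : SimpleGraph (Fin k)} {W C : Finset V} (hC : IsCompOf G H W C) :
    C.card = k := by
  obtain ⟨-, ⟨φ, rfl⟩, -⟩ := hC
  simp

lemma top_preconnected : (⊤ : SimpleGraph (Fin k)).Preconnected :=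
  fun i j => by
    rcases eq_or_ne i j with rfl | h
    · exact SimpleGraph.Reachable.refl _
    · exact SimpleGraph.Adj.reachable (by simpa using h)

instance : DecidableRel chainGraph.Adj := fun i j => by
  unfold chainGraph
  simp only [SimpleGraph.fromRel_adj]
  infer_instance

lemma chainGraph_preconnected : chainGraph.Preconnected := by
  have h2 : ∀ i, chainGraph.Reachable i 2 := by
    have h32 : chainGraph.Reachable 3 2 := SimpleGraph.Adj.reachable (by decide)
    intro i
    fin_cases i
    · exact SimpleGraph.Adj.reachable (by decide)
    · exact SimpleGraph.Adj.reachable (by decide)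
    · exact SimpleGraph.Reachable.refl _
    · exact h32
    · exact (SimpleGraph.Adj.reachable (by decide)).trans h32
    · exact (SimpleGraph.Adj.reachable (by decide)).trans h32
  exact fun i j => (h2 i).trans (h2 j).symm

lemma degIn_of_embedding [DecidableRel G.Adj] {H : SimpleGraph (Fin k)} [DecidableRel H.Adj] {U : Finset V}
    (φ : H ↪g G) (hU : Finset.univ.map φ.toEmbedding ⊆ U)
    (hcl : ∀ x ∈ Finset.univ.map φ.toEmbedding, ∀ y ∈ U, G.Adj x y →
      y ∈ Finset.univ.map φ.toEmbedding) (i : Fin k) :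
    degIn G U (φ i) = H.degree i := by
  have : nbrs G U (φ i) = (H.neighborFinset i).map φ.toEmbedding := by
    ext y
    simp only [mem_nbrs, Finset.mem_map, SimpleGraph.mem_neighborFinset]
    constructor
    · rintro ⟨hy, hadj⟩
      obtain ⟨j, -, rfl⟩ := Finset.mem_map.1 (hcl (φ i) (by simp) y hy hadj)
      exact ⟨j, φ.map_rel_iff.1 hadj, rfl⟩
    · rintro ⟨j, hj, rfl⟩
      exact ⟨hU (by simp), φ.map_rel_iff.2 hj⟩
  rw [degIn, this, Finset.card_map, SimpleGraph.card_neighborFinset_eq_degree]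

variable [DecidableEq V]

lemma card_comps_sdiff_le (H : SimpleGraph (Fin k)) (W S : Finset V) :
    (comps G H (W \ S)).card ≤ (comps G H W).card + (newComps G H W S).card := by
  classical
  have h : comps G H (W \ S) ⊆ comps G H W ∪ newComps G H W S := by
    intro C hC
    by_cases h : C ∈ comps G H W
    · exact Finset.mem_union_left _ h
    · refine Finset.mem_union_right _ ?_
      rw [mem_newComps, ← mem_comps, ← mem_comps]
      exact ⟨hC, h⟩
  exact (Finset.card_le_card h).trans (Finset.card_union_le _ _)

lemma card_comps_sdiff_lt {H : SimpleGraph (Fin k)} {W S D : Finset V}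
    (hD : IsCompOf G H W D) (hDS : ¬ Disjoint D S) :
    (comps G H (W \ S)).card + 1 ≤ (comps G H W).card + (newComps G H W S).card := by
  classical
  have h : comps G H (W \ S) ⊆ (comps G H W).erase D ∪ newComps G H W S := by
    intro C hC
    by_cases h : C ∈ comps G H W
    · refine Finset.mem_union_left _ (Finset.mem_erase.2 ⟨?_, h⟩)
      rintro rfl
      exact hDS (Finset.sdiff_disjoint.mono_left (mem_comps.1 hC).1)
    · refine Finset.mem_union_right _ ?_
      rw [mem_newComps, ← mem_comps, ← mem_comps]
      exact ⟨hC, h⟩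
  have h1 := (Finset.card_le_card h).trans (Finset.card_union_le _ _)
  have h2 := Finset.card_erase_add_one (mem_comps.2 hD)
  omega

lemma cost_sdiff_le (W S : Finset V) :
    cost G (W \ S) ≤ cost G W + 2 * (newComps G (⊤ : SimpleGraph (Fin 3)) W S).card
      + (newComps G chainGraph W S).card := by
  have h3 := card_comps_sdiff_le (G := G) (⊤ : SimpleGraph (Fin 3)) W S
  have h6 := card_comps_sdiff_le (G := G) chainGraph W S
  unfold cost
  omega

variable [DecidableRel G.Adj]

lemma one_le_cross_of_mem_newComps {H : SimpleGraph (Fin k)} {W S C : Finset V}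
    (hC : C ∈ newComps G H W S) : 1 ≤ cross G C S := by
  rw [mem_newComps] at hC
  obtain ⟨⟨h1, h2, h3⟩, h4⟩ := hC
  by_contra h0
  have h0 : cross G C S = 0 := by omega
  refine h4 ⟨h1.trans Finset.sdiff_subset, h2, fun x hx y hy hxy => ?_⟩
  by_cases hyS : y ∈ S
  · have hx0 : degIn G S x = 0 := Finset.sum_eq_zero_iff.1 h0 x hx
    have : y ∈ nbrs G S x := mem_nbrs.2 ⟨hyS, hxy⟩
    rw [Finset.card_eq_zero.1 hx0] at this
    simp at this
  · exact h3 x hx y (Finset.mem_sdiff.2 ⟨hy, hyS⟩) hxy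

lemma mul_card_newComps_le {W S : Finset V} {r s : ℕ}
    (h3 : ∀ C ∈ newComps G (⊤ : SimpleGraph (Fin 3)) W S, r ≤ cross G C S)
    (h6 : ∀ C ∈ newComps G chainGraph W S, s ≤ cross G C S) :
    (newComps G (⊤ : SimpleGraph (Fin 3)) W S).card * r + (newComps G chainGraph W S).card * s
      ≤ cross G S (W \ S) := by
  classical
  set A := newComps G (⊤ : SimpleGraph (Fin 3)) W S with hA
  set B := newComps G chainGraph W S with hB
  have hAB : Disjoint A B := by
    rw [Finset.disjoint_left]
    intro C hCA hCB
    have := (mem_newComps.1 hCA).1.card_eq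
    have := (mem_newComps.1 hCB).1.card_eq
    omega
  have hmem : ∀ C ∈ A ∪ B, ∃ k, ∃ H : SimpleGraph (Fin k), H.Preconnected ∧
      IsCompOf G H (W \ S) C := by
    intro C hC
    rcases Finset.mem_union.1 hC with h | h
    · exact ⟨3, _, top_preconnected, (mem_newComps.1 h).1⟩
    · exact ⟨6, _, chainGraph_preconnected, (mem_newComps.1 h).1⟩
  have hle : ∑ C ∈ A ∪ B, cross G C S ≤ cross G S (W \ S) := by
    refine sum_cross_le (fun C hC => ?_) ?_
    · obtain ⟨k, H, -, h⟩ := hmem C hC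
      exact h.1
    · intro C hC D hD hne
      obtain ⟨k, H, hH, hCc⟩ := hmem C hC
      obtain ⟨l, K, hK, hDc⟩ := hmem D hD
      refine Finset.disjoint_left.2 fun x hxC hxD => hne ?_
      exact hCc.eq_of_mem hH hK hDc hxC hxD
  rw [Finset.sum_union hAB] at hle
  have h1 := Finset.card_nsmul_le_sum A _ r h3
  have h2 := Finset.card_nsmul_le_sum B _ s h6
  simp only [smul_eq_mul] at h1 h2
  omega

lemma card_newComps_le (W S : Finset V) :
    (newComps G (⊤ : SimpleGraph (Fin 3)) W S).card + (newComps G chainGraph W S).card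
      ≤ cross G S (W \ S) := by
  simpa using mul_card_newComps_le (G := G) (W := W) (S := S) (r := 1) (s := 1)
    (fun _ h => one_le_cross_of_mem_newComps h) (fun _ h => one_le_cross_of_mem_newComps h)

/-- `v` lies on a triangle of `G[W]`. -/
def InTriangle (G : SimpleGraph V) (W : Finset V) (v : V) : Prop :=
  ∃ p ∈ W, ∃ q ∈ W, G.Adj v p ∧ G.Adj p q ∧ G.Adj q v

lemma le_degIn_of_isCompOf {H : SimpleGraph (Fin k)} [DecidableRel H.Adj] {W S : Finset V}
    (hSW : S ⊆ W) {δ : ℕ} (hδ : ∀ v ∈ W, InTriangle G W v → δ ≤ degIn G W v)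
    (φ : H ↪g G) (hC : IsCompOf G H (W \ S) (Finset.univ.map φ.toEmbedding)) {i : Fin k}
    (hi : ∃ j l, H.Adj i j ∧ H.Adj j l ∧ H.Adj l i) : δ ≤ H.degree i + degIn G S (φ i) := by
  have hW : ∀ j, φ j ∈ W := fun j => Finset.sdiff_subset (hC.1 (by simp))
  obtain ⟨j, l, hij, hjl, hli⟩ := hi
  rw [← degIn_of_embedding φ hC.1 hC.2.2, degIn_sdiff_add hSW]
  exact hδ _ (hW i) ⟨_, hW j, _, hW l, φ.map_rel_iff.2 hij, φ.map_rel_iff.2 hjl,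
    φ.map_rel_iff.2 hli⟩

lemma le_degIn_of_mem_triangle {W S C : Finset V} (hSW : S ⊆ W) {δ : ℕ}
    (hδ : ∀ v ∈ W, InTriangle G W v → δ ≤ degIn G W v)
    (hC : IsCompOf G (⊤ : SimpleGraph (Fin 3)) (W \ S) C) {x : V} (hx : x ∈ C) :
    δ ≤ 2 + degIn G S x := by
  obtain ⟨φ, rfl⟩ := hC.2.1
  obtain ⟨i, -, rfl⟩ := Finset.mem_map.1 hx
  have htri : ∀ i : Fin 3, ∃ j l, (⊤ : SimpleGraph (Fin 3)).Adj i j ∧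
      (⊤ : SimpleGraph (Fin 3)).Adj j l ∧ (⊤ : SimpleGraph (Fin 3)).Adj l i := by decide
  simpa using le_degIn_of_isCompOf hSW hδ φ hC (htri i)

lemma le_cross_triangle {W S C : Finset V} (hSW : S ⊆ W) {δ : ℕ}
    (hδ : ∀ v ∈ W, InTriangle G W v → δ ≤ degIn G W v)
    (hC : IsCompOf G (⊤ : SimpleGraph (Fin 3)) (W \ S) C) : 3 * (δ - 2) ≤ cross G C S := by
  have := Finset.card_nsmul_le_sum C (degIn G S) (δ - 2) fun x hx => by
    have := le_degIn_of_mem_triangle hSW hδ hC hx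
    omega
  rwa [hC.card_eq, smul_eq_mul] at this

lemma le_cross_chain {W S C : Finset V} (hSW : S ⊆ W) {δ : ℕ}
    (hδ : ∀ v ∈ W, InTriangle G W v → δ ≤ degIn G W v)
    (hC : IsCompOf G chainGraph (W \ S) C) : 4 * (δ - 2) ≤ cross G C S := by
  obtain ⟨φ, rfl⟩ := hC.2.1
  have h : ∀ i, δ ≤ chainGraph.degree i + degIn G S (φ i) := fun i =>
    le_degIn_of_isCompOf hSW hδ φ hC (i := i) (by revert i; decide)
  have h0 := h 0
  have h1 := h 1
  have h4 := h 4
  have h5 := h 5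
  have e0 : chainGraph.degree 0 = 2 := by decide
  have e1 : chainGraph.degree 1 = 2 := by decide
  have e4 : chainGraph.degree 4 = 2 := by decide
  have e5 : chainGraph.degree 5 = 2 := by decide
  have : cross G (Finset.univ.map φ.toEmbedding) S = ∑ i, degIn G S (φ i) := by
    simp [cross]
  rw [this, Fin.sum_univ_six]
  omega

lemma card_newComps_le_of_degree {W S : Finset V} (hSW : S ⊆ W) {δ : ℕ}
    (hδ : ∀ v ∈ W, InTriangle G W v → δ ≤ degIn G W v) :
    (newComps G (⊤ : SimpleGraph (Fin 3)) W S).card * (3 * (δ - 2)) +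
      (newComps G chainGraph W S).card * (4 * (δ - 2)) ≤ cross G S (W \ S) :=
  mul_card_newComps_le (fun _ h => le_cross_triangle hSW hδ (mem_newComps.1 h).1)
    (fun _ h => le_cross_chain hSW hδ (mem_newComps.1 h).1)

end Components

section Reduction

variable {V : Type} [DecidableEq V] {G : SimpleGraph V} [DecidableRel G.Adj]

variable (G) in
/-- The inequality `34 α ≥ 15 |W| - 3 e(W) - cost W` (doubled) for the induced graph `G[W]`. -/
def HasLargeIndep (W : Finset V) : Prop :=
  ∃ I ⊆ W, IsIndepSet G I ∧ 30 * W.card ≤ 68 * I.card + 3 * cross G W W + 2 * cost G W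

lemma hasLargeIndep_of_sdiff {W S J : Finset V} (hSW : S ⊆ W)
    (hIH : HasLargeIndep G (W \ S)) (hJS : J ⊆ S) (hJ : IsIndepSet G J)
    (hJN : ∀ x ∈ J, ∀ y ∈ W, G.Adj x y → y ∈ S)
    (h : 30 * S.card + 2 * cost G (W \ S) ≤
      68 * J.card + 3 * cross G S S + 6 * cross G S (W \ S) + 2 * cost G W) :
    HasLargeIndep G W := by
  obtain ⟨I, hIW, hI, hcard⟩ := hIH
  have hJI : ∀ x ∈ J, ∀ y ∈ I, ¬ G.Adj x y := fun x hx y hy hxy =>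
    (Finset.mem_sdiff.1 (hIW hy)).2 (hJN x hx y (Finset.mem_sdiff.1 (hIW hy)).1 hxy)
  have hd : Disjoint I J := (Finset.sdiff_disjoint.mono_left hIW).mono_right hJS
  refine ⟨I ∪ J, Finset.union_subset (hIW.trans Finset.sdiff_subset) (hJS.trans hSW), ?_, ?_⟩
  · intro x hx y hy hxy
    rcases Finset.mem_union.1 hx with hx | hx <;> rcases Finset.mem_union.1 hy with hy | hy
    · exact hI x hx y hy hxy
    · exact hJI y hy x hx hxy.symm
    · exact hJI x hx y hy hxy
    · exact hJ x hx y hy hxy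
  · rw [Finset.card_union_of_disjoint hd]
    have h1 := Finset.card_sdiff_add_card_eq_card hSW
    have h2 := cross_self_eq (G := G) hSW
    omega

variable (G) in
/-- The closed neighbourhood of `v` in `G[W]`. -/
def star (W : Finset V) (v : V) : Finset V := insert v (nbrs G W v)

omit [DecidableEq V] in
lemma notMem_nbrs_self (W : Finset V) (v : V) : v ∉ nbrs G W v := by simp [mem_nbrs]

lemma card_star (W : Finset V) (v : V) : (star G W v).card = degIn G W v + 1 :=
  Finset.card_insert_of_notMem (notMem_nbrs_self W v)

lemma star_subset {W : Finset V} {v : V} (hv : v ∈ W) : star G W v ⊆ W :=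
  Finset.insert_subset hv (nbrs_subset W v)

lemma mem_star_self (W : Finset V) (v : V) : v ∈ star G W v := Finset.mem_insert_self _ _

lemma mem_star_of_adj {W : Finset V} {v x : V} (hx : x ∈ W) (h : G.Adj v x) : x ∈ star G W v :=
  Finset.mem_insert_of_mem (mem_nbrs.2 ⟨hx, h⟩)

lemma degIn_star_self {W : Finset V} {v : V} (hv : v ∈ W) :
    degIn G (star G W v) v = degIn G W v := by
  have : nbrs G (star G W v) v = nbrs G W v := by
    ext x
    simp only [mem_nbrs]
    exact ⟨fun h => ⟨star_subset hv h.1, h.2⟩, fun h => ⟨mem_star_of_adj h.1 h.2, h.2⟩⟩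
  rw [degIn, this, degIn]

lemma degIn_insert {A : Finset V} {v x : V} (hv : v ∉ A) (h : G.Adj x v) :
    degIn G (insert v A) x = degIn G A x + 1 := by
  rw [degIn_eq_sum, Finset.sum_insert hv, if_pos h, ← degIn_eq_sum, add_comm]

lemma degIn_star {W : Finset V} {v x : V} (hx : x ∈ nbrs G W v) :
    degIn G (star G W v) x = degIn G (nbrs G W v) x + 1 :=
  degIn_insert (notMem_nbrs_self W v) (mem_nbrs.1 hx).2.symm

lemma cross_star {W : Finset V} {v : V} (hv : v ∈ W) :
    cross G (star G W v) (star G W v) =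
      2 * degIn G W v + cross G (nbrs G W v) (nbrs G W v) := by
  have : cross G (star G W v) (star G W v) =
      degIn G (star G W v) v + ∑ x ∈ nbrs G W v, degIn G (star G W v) x :=
    Finset.sum_insert (notMem_nbrs_self W v)
  rw [this, degIn_star_self hv, Finset.sum_congr rfl fun x hx => degIn_star hx,
    Finset.sum_add_distrib, Finset.sum_const, smul_eq_mul, cross]
  simp only [degIn]
  ring

lemma sum_degIn_nbrs {W : Finset V} {v : V} (hv : v ∈ W) :
    ∑ x ∈ nbrs G W v, degIn G W x = degIn G W v + cross G (nbrs G W v) (nbrs G W v)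
      + cross G (star G W v) (W \ star G W v) := by
  have h1 := cross_add_cross_sdiff (G := G) (star_subset (G := G) hv)
  have h2 : ∑ x ∈ star G W v, degIn G W x = degIn G W v + ∑ x ∈ nbrs G W v, degIn G W x :=
    Finset.sum_insert (notMem_nbrs_self W v)
  rw [cross_star hv, h2] at h1
  omega

lemma hasLargeIndep_of_cost_star {W : Finset V} (hIH : ∀ U, U ⊂ W → HasLargeIndep G U)
    {v : V} (hv : v ∈ W)
    (h : 24 * degIn G W v + 2 * cost G (W \ star G W v) ≤
      38 + 3 * cross G (nbrs G W v) (nbrs G W v)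
      + 6 * cross G (star G W v) (W \ star G W v) + 2 * cost G W) :
    HasLargeIndep G W := by
  have hJ : IsIndepSet G {v} := by simp [IsIndepSet]
  refine hasLargeIndep_of_sdiff (star_subset hv)
    (hIH _ (Finset.sdiff_ssubset (star_subset (G := G) hv) ⟨v, mem_star_self W v⟩))
    (Finset.singleton_subset_iff.2 (mem_star_self W v)) hJ ?_ ?_
  · intro x hx y hy hxy
    rw [Finset.mem_singleton] at hx
    subst hx
    exact mem_star_of_adj hy hxy
  · rw [card_star, cross_star hv, Finset.card_singleton]
    omega

lemma hasLargeIndep_of_star {W : Finset V} (hIH : ∀ U, U ⊂ W → HasLargeIndep G U)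
    {v : V} (hv : v ∈ W)
    (h : 24 * degIn G W v + 4 * (newComps G (⊤ : SimpleGraph (Fin 3)) W (star G W v)).card
        + 2 * (newComps G chainGraph W (star G W v)).card ≤
      38 + 3 * cross G (nbrs G W v) (nbrs G W v)
      + 6 * cross G (star G W v) (W \ star G W v)) :
    HasLargeIndep G W := by
  refine hasLargeIndep_of_cost_star hIH hv ?_
  have := cost_sdiff_le (G := G) W (star G W v)
  omega

lemma hasLargeIndep_of_degIn_le_one {W : Finset V} (hIH : ∀ U, U ⊂ W → HasLargeIndep G U)
    {v : V} (hv : v ∈ W) (hd : degIn G W v ≤ 1) : HasLargeIndep G W := by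
  refine hasLargeIndep_of_star hIH hv ?_
  have := card_newComps_le (G := G) W (star G W v)
  omega

omit [DecidableEq V] in
lemma cross_nbrs_eq_zero {W : Finset V} {v : V} (hv : ¬ InTriangle G W v) :
    cross G (nbrs G W v) (nbrs G W v) = 0 := by
  refine Finset.sum_eq_zero fun x hx => ?_
  rw [degIn, Finset.card_eq_zero, Finset.eq_empty_iff_forall_notMem]
  intro y hy
  simp only [mem_nbrs] at hx hy
  exact hv ⟨x, hx.1, y, hy.1.1, hx.2, hy.2, hy.1.2.symm⟩

lemma degree_sum_le {W : Finset V} {v : V} (hv : v ∈ W) {δ : ℕ}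
    (hδ : ∀ x ∈ W, δ ≤ degIn G W x) :
    degIn G W v * δ ≤ degIn G W v + cross G (nbrs G W v) (nbrs G W v)
      + cross G (star G W v) (W \ star G W v) := by
  rw [← sum_degIn_nbrs hv]
  exact Finset.card_nsmul_le_sum _ _ _ fun x hx => hδ x (nbrs_subset W v hx)

lemma hasLargeIndep_of_degIn_eq_two {W : Finset V} (hIH : ∀ U, U ⊂ W → HasLargeIndep G U)
    {v : V} (hv : v ∈ W) (hd : degIn G W v = 2) (hvt : ¬ InTriangle G W v)
    (h2 : ∀ x ∈ W, 2 ≤ degIn G W x) (h3 : ∀ x ∈ W, InTriangle G W x → 3 ≤ degIn G W x) :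
    HasLargeIndep G W := by
  refine hasLargeIndep_of_star hIH hv ?_
  have := card_newComps_le_of_degree (star_subset (G := G) hv) h3
  have hs := degree_sum_le hv h2
  have := cross_nbrs_eq_zero hvt
  rw [hd] at hs ⊢
  omega

omit [DecidableEq V] [DecidableRel G.Adj] in
lemma not_diamond (hG : ¬ HasTriangleAdjC4 G) {a b c d : V} (hab : G.Adj a b) (hbc : G.Adj b c)
    (hca : G.Adj c a) (hbd : G.Adj b d) (hda : G.Adj d a) : c = d := by
  by_contra hcd
  exact hG ⟨a, c, b, b, d, hca.symm, hbc.symm, hab.symm, hbc.symm, hbd, hda, hab.ne, hcd⟩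

omit [DecidableEq V] in
lemma degIn_nbrs_le_one (hG : ¬ HasTriangleAdjC4 G) {W : Finset V} {v x : V}
    (hx : x ∈ nbrs G W v) : degIn G (nbrs G W v) x ≤ 1 := by
  rw [degIn, Finset.card_le_one]
  intro a ha b hb
  simp only [mem_nbrs] at ha hb hx
  exact not_diamond hG hx.2 ha.2 ha.1.2.symm hb.2 hb.1.2.symm

omit [DecidableEq V] in
lemma cross_nbrs_le (hG : ¬ HasTriangleAdjC4 G) (W : Finset V) (v : V) :
    cross G (nbrs G W v) (nbrs G W v) ≤ degIn G W v := by
  have := Finset.sum_le_card_nsmul (nbrs G W v) (degIn G (nbrs G W v)) 1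
    fun x hx => degIn_nbrs_le_one hG hx
  rwa [smul_eq_mul, mul_one] at this

lemma hasLargeIndep_of_four_le (hG : ¬ HasTriangleAdjC4 G) {W : Finset V}
    (hIH : ∀ U, U ⊂ W → HasLargeIndep G U) {v : V} (hv : v ∈ W)
    (h4 : 4 ≤ degIn G W v) (hmin : ∀ x ∈ W, degIn G W v ≤ degIn G W x) :
    HasLargeIndep G W := by
  refine hasLargeIndep_of_star hIH hv ?_
  have hδ : ∀ x ∈ W, InTriangle G W x → 4 ≤ degIn G W x := fun x hx _ => h4.trans (hmin x hx)
  have hn := card_newComps_le_of_degree (star_subset (G := G) hv) hδ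
  have hs := degree_sum_le hv hmin
  have ht := cross_nbrs_le hG W v
  by_cases h5 : degIn G W v = 4
  · rw [h5] at ht hs ⊢
    by_cases h4t : cross G (nbrs G W v) (nbrs G W v) = 4
    · have h3 : newComps G (⊤ : SimpleGraph (Fin 3)) W (star G W v) = ∅ := by
        rw [Finset.eq_empty_iff_forall_notMem]
        intro T hT
        have hT := (mem_newComps.1 hT).1
        obtain ⟨a, ha⟩ : T.Nonempty := by
          rw [← Finset.card_pos, hT.card_eq]
          omega
        have ha2 := le_degIn_of_mem_triangle (star_subset hv) hδ hT ha
        have haW := Finset.mem_sdiff.1 (hT.1 ha)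
        have hav : ¬ G.Adj v a := fun h => haW.2 (mem_star_of_adj haW.1 h)
        obtain ⟨x, hx, y, hy, hxy⟩ := Finset.one_lt_card.1 (show 1 < (nbrs G (star G W v) a).card by
          unfold degIn at ha2; omega)
        have key : ∀ z ∈ nbrs G (star G W v) a, z ∈ nbrs G W v := by
          intro z hz
          rcases Finset.mem_insert.1 (mem_nbrs.1 hz).1 with rfl | h
          · exact absurd (mem_nbrs.1 hz).2.symm hav
          · exact h
        have hxN := key x hx
        have hyN := key y hy
        have hpos : 1 ≤ degIn G (nbrs G W v) x := by
          by_contra h0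
          have hlt : cross G (nbrs G W v) (nbrs G W v) < ∑ _z ∈ nbrs G W v, 1 :=
            Finset.sum_lt_sum (fun z hz => degIn_nbrs_le_one hG hz) ⟨x, hxN, by omega⟩
          rw [Finset.sum_const, smul_eq_mul, mul_one] at hlt
          unfold degIn at h5
          omega
        obtain ⟨z, hz⟩ := Finset.card_pos.1 hpos
        simp only [mem_nbrs] at hx hy hxN hyN hz
        refine hG ⟨v, x, z, a, y, hxN.2, hz.2, hz.1.2.symm, hx.2.symm, hy.2, hyN.2.symm, ?_, hxy⟩
        rintro rfl
        exact haW.2 (mem_star_self W v)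
      rw [h3, Finset.card_empty] at hn ⊢
      omega
    · have hn' : (newComps G (⊤ : SimpleGraph (Fin 3)) W (star G W v)).card +
          (newComps G chainGraph W (star G W v)).card ≤
          cross G (star G W v) (W \ star G W v) / 6 := by omega
      omega
  · have h5 : 5 ≤ degIn G W v := by omega
    set d := degIn G W v
    rcases h5.eq_or_lt with h | h
    · rw [← h] at hs ht ⊢
      omega
    · have : 6 * d ≤ d * d := Nat.mul_le_mul_right d h
      omega

end Reduction

section SmallDegree

variable {V : Type} [DecidableEq V] {G : SimpleGraph V}

omit [DecidableEq V] in
lemma IsCompOf.adj_of_ne {U C : Finset V} (hC : IsCompOf G (⊤ : SimpleGraph (Fin 3)) U C)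
    {x y : V} (hx : x ∈ C) (hy : y ∈ C) (hxy : x ≠ y) : G.Adj x y := by
  obtain ⟨-, ⟨φ, rfl⟩, -⟩ := hC
  obtain ⟨i, -, rfl⟩ := Finset.mem_map.1 hx
  obtain ⟨j, -, rfl⟩ := Finset.mem_map.1 hy
  refine φ.map_rel_iff.2 ?_
  rw [SimpleGraph.top_adj]
  rintro rfl
  exact hxy rfl

lemma IsCompOf.exists_eq_triple {U C : Finset V}
    (hC : IsCompOf G (⊤ : SimpleGraph (Fin 3)) U C) {t : V} (ht : t ∈ C) :
    ∃ p q, C = {t, p, q} ∧ G.Adj t p ∧ G.Adj p q ∧ G.Adj q t := by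
  have h2 : (C.erase t).card = 2 := by rw [Finset.card_erase_of_mem ht, hC.card_eq]
  obtain ⟨p, q, hpq, h⟩ := Finset.card_eq_two.1 h2
  have hp : p ∈ C.erase t := by simp [h]
  have hq : q ∈ C.erase t := by simp [h]
  rw [Finset.mem_erase] at hp hq
  exact ⟨p, q, by rw [← h, Finset.insert_erase ht], hC.adj_of_ne ht hp.2 hp.1.symm,
    hC.adj_of_ne hp.2 hq.2 hpq, hC.adj_of_ne hq.2 ht hq.1⟩

lemma isCompOf_of_adj_iff {k : ℕ} {H : SimpleGraph (Fin k)} {W C : Finset V} (f : Fin k → V)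
    (hH : ∀ i j, (∀ l, H.Adj i l ↔ H.Adj j l) → i = j)
    (hf : ∀ i j, i < j → (G.Adj (f i) (f j) ↔ H.Adj i j)) (hC : C = Finset.univ.image f)
    (hCW : C ⊆ W) (hcl : ∀ x ∈ C, ∀ y ∈ W, G.Adj x y → y ∈ C) : IsCompOf G H W C := by
  have hadj : ∀ i j, G.Adj (f i) (f j) ↔ H.Adj i j := by
    intro i j
    rcases lt_trichotomy i j with h | rfl | h
    · exact hf i j h
    · simp
    · rw [G.adj_comm, H.adj_comm, hf j i h]
  have hinj : Function.Injective f := fun i j hij => hH i j fun l => by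
    rw [← hadj, ← hadj, hij]
  refine ⟨hCW, ⟨⟨⟨f, hinj⟩, @fun i j => hadj i j⟩, ?_⟩, hcl⟩
  rw [hC, Finset.map_eq_image]
  rfl

lemma isCompOf_triangle {W : Finset V} {a b c : V} (hW : {a, b, c} ⊆ W)
    (hab : G.Adj a b) (hbc : G.Adj b c) (hca : G.Adj c a)
    (hcl : ∀ x ∈ ({a, b, c} : Finset V), ∀ y ∈ W, G.Adj x y → y ∈ ({a, b, c} : Finset V)) :
    IsCompOf G (⊤ : SimpleGraph (Fin 3)) W {a, b, c} := by
  refine isCompOf_of_adj_iff ![a, b, c] (by decide) ?_ ?_ hW hcl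
  · simp [Fin.forall_fin_succ, hab, hbc, hca.symm]
  · ext x
    simp [Fin.exists_fin_succ, eq_comm]

lemma isCompOf_chain {W : Finset V} {a b c d e f : V} (hW : {a, b, c, d, e, f} ⊆ W)
    (hab : G.Adj a b) (hbc : G.Adj b c) (hca : G.Adj c a) (hcd : G.Adj c d)
    (hde : G.Adj d e) (hef : G.Adj e f) (hfd : G.Adj f d)
    (had : ¬ G.Adj a d) (hae : ¬ G.Adj a e) (haf : ¬ G.Adj a f)
    (hbd : ¬ G.Adj b d) (hbe : ¬ G.Adj b e) (hbf : ¬ G.Adj b f)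
    (hce : ¬ G.Adj c e) (hcf : ¬ G.Adj c f)
    (hcl : ∀ x ∈ ({a, b, c, d, e, f} : Finset V), ∀ y ∈ W, G.Adj x y →
      y ∈ ({a, b, c, d, e, f} : Finset V)) :
    IsCompOf G chainGraph W {a, b, c, d, e, f} := by
  refine isCompOf_of_adj_iff ![a, b, c, d, e, f] (by decide) ?_ ?_ hW hcl
  · simp [Fin.forall_fin_succ, chainGraph, hab, hbc, hca.symm, hcd, hde, hef, hfd.symm, had, hae,
      haf, hbd, hbe, hbf, hce, hcf]
  · ext x
    simp [Fin.exists_fin_succ, eq_comm]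

variable [DecidableRel G.Adj]

omit [DecidableEq V] in
lemma eq_of_cross_le_one {A B : Finset V} (h : cross G A B ≤ 1) {a a' b b' : V}
    (ha : a ∈ A) (hb : b ∈ B) (hab : G.Adj a b) (ha' : a' ∈ A) (hb' : b' ∈ B)
    (hab' : G.Adj a' b') : a = a' ∧ b = b' := by
  have : cross G A B = ((A ×ˢ B).filter fun p => G.Adj p.1 p.2).card := by
    simp only [cross, degIn_eq_sum, Finset.card_filter, Finset.sum_product]
  rw [this, Finset.card_le_one] at h
  have := h (a, b) (by simp [ha, hb, hab]) (a', b') (by simp [ha', hb', hab'])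
  simpa using this

omit [DecidableEq V] in
lemma degIn_pos {A : Finset V} {x y : V} (hy : y ∈ A) (h : G.Adj x y) : 1 ≤ degIn G A x :=
  Finset.card_pos.2 ⟨y, mem_nbrs.2 ⟨hy, h⟩⟩

lemma hasLargeIndep_of_degIn_eq_two_triangle {W : Finset V}
    (hIH : ∀ U, U ⊂ W → HasLargeIndep G U) {v : V} (hv : v ∈ W) (hd : degIn G W v = 2)
    (hvt : InTriangle G W v) : HasLargeIndep G W := by
  obtain ⟨x, hx, y, hy, hvx, hxy, hyv⟩ := hvt
  have hN : nbrs G W v = {x, y} := by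
    refine (Finset.eq_of_subset_of_card_le ?_ ?_).symm
    · simp [Finset.insert_subset_iff, mem_nbrs, hx, hy, hvx, hyv.symm]
    · rw [Finset.card_pair hxy.ne]; exact hd.le
  have hτ : cross G (nbrs G W v) (nbrs G W v) = 2 := by
    rw [hN]
    simp [cross, degIn_eq_sum, Finset.sum_pair hxy.ne, hxy, hxy.symm]
  have hn := card_newComps_le (G := G) W (star G W v)
  have hS : star G W v = {v, x, y} := by rw [star, hN]
  have hvo : ∀ z ∈ W \ star G W v, ¬ G.Adj v z := fun z hz h =>
    (Finset.mem_sdiff.1 hz).2 (mem_star_of_adj (Finset.mem_sdiff.1 hz).1 h)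
  rcases Nat.lt_or_ge (cross G (star G W v) (W \ star G W v)) 2 with ho | ho
  swap
  · exact hasLargeIndep_of_star hIH hv (by omega)
  by_cases h0 : cross G (star G W v) (W \ star G W v) = 0
  · refine hasLargeIndep_of_cost_star hIH hv ?_
    have hcomp : IsCompOf G (⊤ : SimpleGraph (Fin 3)) W (star G W v) := by
      have hsub := star_subset (G := G) hv
      have hcl : ∀ s ∈ star G W v, ∀ z ∈ W, G.Adj s z → z ∈ star G W v := by
        intro s hs z hz hsz
        by_contra hzS
        have h1 : degIn G (W \ star G W v) s = 0 := Finset.sum_eq_zero_iff.1 h0 s hs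
        have := degIn_pos (Finset.mem_sdiff.2 ⟨hz, hzS⟩) hsz
        omega
      rw [hS] at hsub hcl ⊢
      exact isCompOf_triangle hsub hvx hxy hyv hcl
    have h3 := card_comps_sdiff_lt (S := star G W v) hcomp
      (fun h => Finset.disjoint_left.1 h (mem_star_self W v) (mem_star_self W v))
    have h6 := card_comps_sdiff_le (G := G) chainGraph W (star G W v)
    unfold cost
    omega
  by_cases h3 : newComps G (⊤ : SimpleGraph (Fin 3)) W (star G W v) = ∅
  · refine hasLargeIndep_of_star hIH hv ?_
    rw [h3, Finset.card_empty] at hn ⊢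
    omega
  obtain ⟨T, hT⟩ := Finset.nonempty_iff_ne_empty.2 h3
  have hTc := one_le_cross_of_mem_newComps hT
  obtain ⟨t, ht, htS⟩ := Finset.exists_ne_zero_of_sum_ne_zero (Nat.one_le_iff_ne_zero.1 hTc)
  obtain ⟨s, hs⟩ := Finset.card_pos.1 (Nat.pos_of_ne_zero htS)
  rw [mem_nbrs] at hs
  obtain ⟨hsS, hts⟩ := hs
  have hTcomp := (mem_newComps.1 hT).1
  have huniq : ∀ a ∈ star G W v, ∀ b ∈ W \ star G W v, G.Adj a b → a = s ∧ b = t :=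
    fun a ha b hb hab => eq_of_cross_le_one (by omega) ha hb hab hsS (hTcomp.1 ht) hts.symm
  have hsv : s ≠ v := by
    rintro rfl
    exact hvo t (hTcomp.1 ht) hts.symm
  obtain ⟨r, hr, hrS, hvr, hrs⟩ : ∃ r, r ≠ s ∧ star G W v = {v, r, s} ∧ G.Adj v r ∧
      G.Adj r s ∧ G.Adj s v := by
    rw [hS, Finset.mem_insert, Finset.mem_insert, Finset.mem_singleton] at hsS
    rcases hsS with h | rfl | rfl
    · exact absurd h hsv
    · exact ⟨y, hxy.ne', by rw [hS, Finset.pair_comm], hyv.symm, hxy.symm, hvx.symm⟩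
    · exact ⟨x, hxy.ne, hS, hvx, hxy, hyv⟩
  obtain ⟨p, q, hTeq, htp, hpq, hqt⟩ := hTcomp.exists_eq_triple ht
  have htU := hTcomp.1 ht
  have hpU := hTcomp.1 (show p ∈ T by simp [hTeq])
  have hqU := hTcomp.1 (show q ∈ T by simp [hTeq])
  have hvS : v ∈ star G W v := mem_star_self W v
  have hrS' : r ∈ star G W v := by simp [hrS]
  have hdecomp : ({v, r, s, t, p, q} : Finset V) = star G W v ∪ T := by
    rw [hrS, hTeq]
    ext z
    simp only [Finset.mem_union, Finset.mem_insert, Finset.mem_singleton]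
    tauto
  have hcomp : IsCompOf G chainGraph W {v, r, s, t, p, q} := by
    refine isCompOf_chain ?_ hvr hrs.1 hrs.2 hts.symm htp hpq hqt (hvo t htU) (hvo p hpU)
      (hvo q hqU) (fun h => hr (huniq r hrS' t htU h).1) (fun h => hr (huniq r hrS' p hpU h).1)
      (fun h => hr (huniq r hrS' q hqU h).1) (fun h => htp.ne' (huniq s hsS p hpU h).2)
      (fun h => hqt.ne (huniq s hsS q hqU h).2) ?_
    · rw [hdecomp]
      exact Finset.union_subset (star_subset hv) (hTcomp.1.trans Finset.sdiff_subset)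
    · rw [hdecomp]
      intro a ha b hb hab
      by_cases hbS : b ∈ star G W v
      · exact Finset.mem_union_left _ hbS
      refine Finset.mem_union_right _ ?_
      have hbU := Finset.mem_sdiff.2 ⟨hb, hbS⟩
      rcases Finset.mem_union.1 ha with ha | ha
      · rw [(huniq a ha b hbU hab).2]
        exact ht
      · exact hTcomp.2.2 a ha b hbU hab
  refine hasLargeIndep_of_cost_star hIH hv ?_
  have h6 := card_comps_sdiff_lt (S := star G W v) hcomp
    (fun h => Finset.disjoint_left.1 h (by simp) (mem_star_self W v))
  have h3 := card_comps_sdiff_le (G := G) (⊤ : SimpleGraph (Fin 3)) W (star G W v)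
  unfold cost
  omega

end SmallDegree

section Cubic

variable {V : Type} [DecidableEq V] {G : SimpleGraph V}

lemma IsCompOf.eq_of_adj_of_adj (hG : ¬ HasTriangleAdjC4 G) {U T : Finset V}
    (hT : IsCompOf G (⊤ : SimpleGraph (Fin 3)) U T) {x s t : V} (hx : x ∉ T)
    (hs : s ∈ T) (ht : t ∈ T) (hsx : G.Adj s x) (htx : G.Adj t x) : s = t := by
  by_contra hst
  obtain ⟨p, q, rfl, hsp, hpq, hqs⟩ := hT.exists_eq_triple hs
  have key : ∀ c ∈ ({s, p, q} : Finset V), c ≠ s → c ≠ t → False := fun c hc hcs hct => by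
    have := not_diamond hG (hT.adj_of_ne hs ht hst) (hT.adj_of_ne ht hc (Ne.symm hct))
      (hT.adj_of_ne hc hs hcs) htx hsx.symm
    exact hx (this ▸ hc)
  by_cases hpt : p = t
  · exact key q (by simp) hqs.ne (hpt ▸ hpq.ne')
  · exact key p (by simp) hsp.ne' hpt

variable [DecidableRel G.Adj]

omit [DecidableEq V] in
lemma degIn_of_mem_triangle {U T : Finset V}
    (hT : IsCompOf G (⊤ : SimpleGraph (Fin 3)) U T) {t : V} (ht : t ∈ T) : degIn G U t = 2 := by
  obtain ⟨hTU, ⟨φ, rfl⟩, hcl⟩ := hT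
  obtain ⟨i, -, rfl⟩ := Finset.mem_map.1 ht
  simpa using degIn_of_embedding φ hTU hcl i

/-- In a graph of minimum degree three, the neighbours of a cubic vertex `v` are matched to
the vertices of any triangle that becomes a component when the closed neighbourhood of `v`
is deleted, and this triangle consists of cubic vertices. -/
lemma matching_of_triangle (hG : ¬ HasTriangleAdjC4 G) {W T : Finset V} {v : V} (hv : v ∈ W)
    (hd : degIn G W v = 3) (h3 : ∀ x ∈ W, 3 ≤ degIn G W x)
    (hT : IsCompOf G (⊤ : SimpleGraph (Fin 3)) (W \ star G W v) T) :
    (∀ x ∈ nbrs G W v, ∃ t ∈ T, G.Adj x t) ∧ ∀ t ∈ T, degIn G W t = 3 := by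
  have hTW : ∀ t ∈ T, t ∈ W ∧ t ∉ star G W v := fun t ht => Finset.mem_sdiff.1 (hT.1 ht)
  have hsplit : ∀ t ∈ T, 2 + degIn G (star G W v) t = degIn G W t := fun t ht => by
    rw [← degIn_of_mem_triangle hT ht, degIn_sdiff_add (star_subset hv)]
  have hstar : ∀ t ∈ T, ∀ x ∈ nbrs G (star G W v) t, x ∈ nbrs G W v ∧ G.Adj t x ∧ x ∉ T := by
    intro t ht x hx
    rw [mem_nbrs] at hx
    refine ⟨?_, hx.2, fun h => (hTW x h).2 hx.1⟩
    rcases Finset.mem_insert.1 hx.1 with rfl | h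
    · exact absurd (mem_star_of_adj (hTW t ht).1 hx.2.symm) (hTW t ht).2
    · exact h
  have hex : ∀ t ∈ T, ∃ x, x ∈ nbrs G (star G W v) t := fun t ht => by
    have := hsplit t ht
    have := h3 t (hTW t ht).1
    exact Finset.card_pos.1 (show 0 < degIn G (star G W v) t by omega)
  choose! f hf using hex
  have himg : T.image f = nbrs G W v := by
    refine Finset.eq_of_subset_of_card_le ?_ ?_
    · intro x hx
      obtain ⟨t, ht, rfl⟩ := Finset.mem_image.1 hx
      exact (hstar t ht _ (hf t ht)).1
    · rw [Finset.card_image_of_injOn, hT.card_eq]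
      · exact hd.le
      · intro s hs t ht hst
        have h1 := hstar s hs _ (hf s hs)
        have h2 := hstar t ht _ (hf t ht)
        exact hT.eq_of_adj_of_adj hG h1.2.2 hs ht h1.2.1 (hst ▸ h2.2.1)
  have hmatch : ∀ x ∈ nbrs G W v, ∃ t ∈ T, f t = x := fun x hx => by
    rw [← himg] at hx
    simpa using hx
  refine ⟨fun x hx => ?_, fun t ht => ?_⟩
  · obtain ⟨t, ht, rfl⟩ := hmatch x hx
    exact ⟨t, ht, (hstar t ht _ (hf t ht)).2.1.symm⟩
  · have hle : degIn G (star G W v) t ≤ 1 := by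
      rw [degIn, Finset.card_le_one]
      have key : ∀ x ∈ nbrs G (star G W v) t, x = f t := by
        intro x hx
        obtain ⟨hx1, hx2, hx3⟩ := hstar t ht x hx
        obtain ⟨s, hs, rfl⟩ := hmatch x hx1
        rw [hT.eq_of_adj_of_adj hG hx3 hs ht (hstar s hs _ (hf s hs)).2.1 hx2]
      intro x hx y hy
      rw [key x hx, key y hy]
    have := hsplit t ht
    have := h3 t (hTW t ht).1
    omega

/-- The neighbours of a cubic vertex, once three of them are known. -/
lemma nbrs_eq_triple {W : Finset V} {v x y z : V} (hd : degIn G W v = 3)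
    (hx : x ∈ W) (hy : y ∈ W) (hz : z ∈ W) (hvx : G.Adj v x) (hvy : G.Adj v y) (hvz : G.Adj v z)
    (hxy : x ≠ y) (hyz : y ≠ z) (hxz : x ≠ z) : nbrs G W v = {x, y, z} := by
  refine (Finset.eq_of_subset_of_card_le ?_ ?_).symm
  · simp [Finset.insert_subset_iff, mem_nbrs, hx, hy, hz, hvx, hvy, hvz]
  · rw [Finset.card_eq_three.2 ⟨x, y, z, hxy, hxz, hyz, rfl⟩]
    exact hd.le

lemma exists_third_nbr {W : Finset V} {v x y : V} (hd : degIn G W v = 3)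
    (hx : x ∈ W) (hy : y ∈ W) (hvx : G.Adj v x) (hvy : G.Adj v y) (hxy : x ≠ y) :
    ∃ z ∈ W, G.Adj v z ∧ x ≠ z ∧ y ≠ z ∧ nbrs G W v = {x, y, z} := by
  have : ({x, y} : Finset V).card < (nbrs G W v).card := by
    rw [Finset.card_pair hxy]
    exact hd.ge
  obtain ⟨z, hz, hz'⟩ := Finset.exists_mem_notMem_of_card_lt_card this
  rw [mem_nbrs] at hz
  simp only [Finset.mem_insert, Finset.mem_singleton, not_or] at hz'
  exact ⟨z, hz.1, hz.2, Ne.symm hz'.1, Ne.symm hz'.2,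
    nbrs_eq_triple hd hx hy hz.1 hvx hvy hz.2 hxy (Ne.symm hz'.2) (Ne.symm hz'.1)⟩

omit [DecidableEq V] in
lemma sum_degIn_nbrs_of_three {W : Finset V} {v : V} (hd : degIn G W v = 3)
    (h3 : ∀ x ∈ W, 3 ≤ degIn G W x) {y : V} (hy : y ∈ nbrs G W v) (hy3 : degIn G W y ≠ 3) :
    10 ≤ ∑ x ∈ nbrs G W v, degIn G W x := by
  have h : ∑ _x ∈ nbrs G W v, 3 < ∑ x ∈ nbrs G W v, degIn G W x :=
    Finset.sum_lt_sum (fun x hx => h3 x (nbrs_subset W v hx))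
      ⟨y, hy, lt_of_le_of_ne (h3 y (nbrs_subset W v hy)) (Ne.symm hy3)⟩
  rw [Finset.sum_const, smul_eq_mul] at h
  have : (nbrs G W v).card = 3 := hd
  omega

lemma nbrs_cubic_of_inTriangle (hG : ¬ HasTriangleAdjC4 G) {W : Finset V}
    (hIH : ∀ U, U ⊂ W → HasLargeIndep G U) (hW : ¬ HasLargeIndep G W)
    (h3 : ∀ x ∈ W, 3 ≤ degIn G W x) {v : V} (hv : v ∈ W) (hd : degIn G W v = 3)
    (hvt : InTriangle G W v) : ∀ x ∈ nbrs G W v, degIn G W x = 3 := by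
  intro u hu
  by_contra hu3
  refine hW (hasLargeIndep_of_star hIH hv ?_)
  obtain ⟨x, hx, y, hy, hvx, hxy, hyv⟩ := hvt
  obtain ⟨z, hz, hvz, hxz, hyz, hN⟩ := exists_third_nbr hd hx hy hvx hyv.symm hxy.ne
  have hzx : ¬ G.Adj x z := fun h => hyz (not_diamond hG hvx hxy hyv h hvz.symm)
  have hzy : ¬ G.Adj y z := fun h => hxz (not_diamond hG hyv.symm hxy.symm hvx.symm h hvz.symm)
  have hτ : cross G (nbrs G W v) (nbrs G W v) = 2 := by
    rw [hN]
    simp [cross, degIn, nbrs, Finset.filter_insert, Finset.filter_singleton, hxy.ne, hxz, hyz,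
      hxy, hxy.symm, hzx, hzy, mt SimpleGraph.Adj.symm hzx, mt SimpleGraph.Adj.symm hzy]
  have hn := card_newComps_le_of_degree (star_subset (G := G) hv) fun x hx _ => h3 x hx
  have hs := sum_degIn_nbrs_of_three hd h3 hu hu3
  rw [sum_degIn_nbrs hv] at hs
  have h0 : newComps G (⊤ : SimpleGraph (Fin 3)) W (star G W v) = ∅ := by
    rw [Finset.eq_empty_iff_forall_notMem]
    intro T hT
    have hT := (mem_newComps.1 hT).1
    obtain ⟨a, ha, hxa⟩ := (matching_of_triangle hG hv hd h3 hT).1 x (by simp [hN])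
    obtain ⟨b, hb, hyb⟩ := (matching_of_triangle hG hv hd h3 hT).1 y (by simp [hN])
    have hsd : ∀ s ∈ T, s ∉ star G W v := fun s hs => (Finset.mem_sdiff.1 (hT.1 hs)).2
    have hxS : x ∈ star G W v := mem_star_of_adj hx hvx
    have hyS : y ∈ star G W v := mem_star_of_adj hy hyv.symm
    have hab : a ≠ b := by
      rintro rfl
      have := not_diamond hG hxy hyv hvx hyb hxa.symm
      exact hsd a ha (this ▸ mem_star_self W v)
    refine hG ⟨x, y, v, b, a, hxy, hyv, hvx, hyb, hT.adj_of_ne hb ha hab.symm, hxa.symm, ?_, ?_⟩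
    · rintro rfl
      exact hsd _ hb hxS
    · rintro rfl
      exact hsd _ ha hyS
  rw [h0, Finset.card_empty] at hn ⊢
  rw [hd] at hs ⊢
  omega

lemma exists_triangle_of_not_inTriangle {W : Finset V}
    (hIH : ∀ U, U ⊂ W → HasLargeIndep G U) (hW : ¬ HasLargeIndep G W)
    (h3 : ∀ x ∈ W, 3 ≤ degIn G W x) {v : V} (hv : v ∈ W) (hd : degIn G W v = 3)
    (hvt : ¬ InTriangle G W v) : (∀ x ∈ nbrs G W v, degIn G W x = 3) ∧
      ∃ T, IsCompOf G (⊤ : SimpleGraph (Fin 3)) (W \ star G W v) T := by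
  have hn := card_newComps_le_of_degree (star_subset (G := G) hv) fun x hx _ => h3 x hx
  have hτ := cross_nbrs_eq_zero hvt
  have hs := degree_sum_le hv h3
  constructor
  · intro u hu
    by_contra hu3
    refine hW (hasLargeIndep_of_star hIH hv ?_)
    have hs := sum_degIn_nbrs_of_three hd h3 hu hu3
    rw [sum_degIn_nbrs hv] at hs
    omega
  · by_contra! hT
    refine hW (hasLargeIndep_of_star hIH hv ?_)
    have h0 : newComps G (⊤ : SimpleGraph (Fin 3)) W (star G W v) = ∅ := by
      rw [Finset.eq_empty_iff_forall_notMem]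
      exact fun T h => hT T (mem_newComps.1 h).1
    rw [h0, Finset.card_empty] at hn ⊢
    rw [hd] at hs ⊢
    omega

lemma inTriangle_of_cubic (hG : ¬ HasTriangleAdjC4 G) {W : Finset V}
    (hIH : ∀ U, U ⊂ W → HasLargeIndep G U) (hW : ¬ HasLargeIndep G W)
    (h3 : ∀ x ∈ W, 3 ≤ degIn G W x) {v : V} (hv : v ∈ W) (hd : degIn G W v = 3) :
    InTriangle G W v := by
  by_contra hvt
  obtain ⟨hN3, T, hT⟩ := exists_triangle_of_not_inTriangle hIH hW h3 hv hd hvt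
  obtain ⟨hm, hT3⟩ := matching_of_triangle hG hv hd h3 hT
  have hTW : ∀ t ∈ T, t ∈ W ∧ t ∉ star G W v := fun t ht => Finset.mem_sdiff.1 (hT.1 ht)
  obtain ⟨x, hxN⟩ := Finset.card_pos.1 (show 0 < (nbrs G W v).card by
    rw [← degIn, hd]; omega)
  obtain ⟨t, ht, hxt⟩ := hm x hxN
  have hd_x := hN3 x hxN
  have hxS : x ∈ star G W v := Finset.mem_insert_of_mem hxN
  obtain ⟨hxW, hvx⟩ := mem_nbrs.1 hxN
  have hxT : x ∉ T := fun h => (hTW x h).2 hxS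
  have htv : t ≠ v := by
    rintro rfl
    exact (hTW _ ht).2 (mem_star_self W _)
  obtain ⟨p, q, hTeq, htp, hpq, hqt⟩ := hT.exists_eq_triple ht
  have hpT : p ∈ T := by simp [hTeq]
  have hqT : q ∈ T := by simp [hTeq]
  have hNt : nbrs G W t = {x, p, q} :=
    nbrs_eq_triple (hT3 t ht) hxW (hTW p hpT).1 (hTW q hqT).1 hxt.symm htp hqt.symm
      (fun h => hxT (h ▸ hpT)) hpq.ne (fun h => hxT (h ▸ hqT))
  have htT : ∀ u ∈ W, G.Adj t u → u ≠ x → u ∈ T := by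
    intro u hu htu hux
    have : u ∈ nbrs G W t := mem_nbrs.2 ⟨hu, htu⟩
    rw [hNt] at this
    rw [hTeq]
    simp only [Finset.mem_insert, Finset.mem_singleton] at this ⊢
    tauto
  have hxnt : ¬ InTriangle G W x := by
    rintro ⟨r, hr, s, hs, hxr, hrs, hsx⟩
    have hrv : r ≠ v := by
      rintro rfl
      exact hvt ⟨s, hs, x, hxW, hrs, hsx, hxr⟩
    have hsv : s ≠ v := by
      rintro rfl
      exact hvt ⟨x, hxW, r, hr, hvx, hxr, hrs⟩
    have key : ∀ u ∈ W, G.Adj t u → G.Adj u x → False := by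
      intro u hu htu hux
      have huT := htT u hu htu hux.ne
      exact htu.ne (hT.eq_of_adj_of_adj hG hxT ht huT hxt.symm hux)
    obtain ⟨z, hz, hxz, hvz, htz, hNx⟩ :=
      exists_third_nbr hd_x hv (hTW t ht).1 hvx.symm hxt htv.symm
    have hrN : r ∈ nbrs G W x := mem_nbrs.2 ⟨hr, hxr⟩
    have hsN : s ∈ nbrs G W x := mem_nbrs.2 ⟨hs, hsx.symm⟩
    rw [hNx] at hrN hsN
    simp only [Finset.mem_insert, Finset.mem_singleton, hrv, hsv, false_or] at hrN hsN
    rcases hrN with rfl | rfl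
    · exact key s hs hrs hsx
    · rcases hsN with rfl | rfl
      · exact key r hr hrs.symm hxr.symm
      · exact hrs.ne rfl
  obtain ⟨-, R, hR⟩ := exists_triangle_of_not_inTriangle hIH hW h3 hxW hd_x hxnt
  obtain ⟨s, hs, hts⟩ := (matching_of_triangle hG hxW hd_x h3 hR).1 t
    (mem_nbrs.2 ⟨(hTW t ht).1, hxt⟩)
  have hRW : ∀ u ∈ R, u ∈ W ∧ u ∉ star G W x := fun u hu => Finset.mem_sdiff.1 (hR.1 hu)
  have hsT : s ∈ T :=
    htT s (hRW s hs).1 hts (by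
      rintro rfl
      exact (hRW _ hs).2 (mem_star_self W _))
  have htR : t ∉ R := fun h => (hRW t h).2 (mem_star_of_adj (hTW t ht).1 hxt)
  obtain ⟨c, d, hReq, hsc, hcd, hds⟩ := hR.exists_eq_triple hs
  have hcR : c ∈ R := by simp [hReq]
  have hdR : d ∈ R := by simp [hReq]
  have hNs : nbrs G W s = {t, c, d} :=
    nbrs_eq_triple (hT3 s hsT) (hTW t ht).1 (hRW c hcR).1 (hRW d hdR).1 hts.symm hsc hds.symm
      (fun h => htR (h ▸ hcR)) hcd.ne (fun h => htR (h ▸ hdR))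
  obtain ⟨u, huT, hut, hus⟩ : ∃ u ∈ T, u ≠ t ∧ u ≠ s := by
    have : ({t, s} : Finset V).card < T.card := by
      rw [Finset.card_pair hts.ne, hT.card_eq]
      omega
    obtain ⟨u, hu, hu'⟩ := Finset.exists_mem_notMem_of_card_lt_card this
    simp only [Finset.mem_insert, Finset.mem_singleton, not_or] at hu'
    exact ⟨u, hu, hu'⟩
  have huN : u ∈ nbrs G W s := mem_nbrs.2 ⟨(hTW u huT).1, hT.adj_of_ne hsT huT hus.symm⟩
  have huR : u ∈ R := by
    rw [hNs] at huN
    rw [hReq]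
    simp only [Finset.mem_insert, Finset.mem_singleton] at huN ⊢
    tauto
  exact hus (hR.eq_of_adj_of_adj hG htR huR hs (hT.adj_of_ne huT ht hut) hts.symm)

end Cubic

section SevenVertices

variable {V : Type} [DecidableEq V] {G : SimpleGraph V} [DecidableRel G.Adj]

/-- If `p` is a cubic vertex of a triangle `p q r`, then its third neighbour `s` has no common
neighbour with `p`. -/
lemma no_common_nbr_of_cubic (hG : ¬ HasTriangleAdjC4 G) {W : Finset V} {p q r s : V}
    (hd : degIn G W p = 3) (hq : q ∈ W) (hr : r ∈ W) (hs : s ∈ W) (hpq : G.Adj p q)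
    (hqr : G.Adj q r) (hrp : G.Adj r p) (hps : G.Adj p s) (hqs : q ≠ s) (hrs : r ≠ s) :
    ∀ t ∈ W, G.Adj p t → ¬ G.Adj t s := by
  intro t ht hpt hts
  have htN : t ∈ nbrs G W p := mem_nbrs.2 ⟨ht, hpt⟩
  rw [nbrs_eq_triple hd hq hr hs hpq hrp.symm hps hqr.ne hrs hqs] at htN
  simp only [Finset.mem_insert, Finset.mem_singleton] at htN
  rcases htN with rfl | rfl | rfl
  · exact hrs (not_diamond hG hpq hqr hrp hts hps.symm)
  · exact hqs (not_diamond hG hrp.symm hqr.symm hpq.symm hts hps.symm)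
  · exact hts.ne rfl

/-- A cubic vertex of a triangle has at most one neighbour with which it shares no neighbour. -/
lemma eq_of_no_common_nbr {W : Finset V} {p s t : V} (hd : degIn G W p = 3)
    (hp : InTriangle G W p) (hs : s ∈ W) (ht : t ∈ W) (hps : G.Adj p s) (hpt : G.Adj p t)
    (hs' : ∀ x ∈ W, G.Adj p x → ¬ G.Adj x s) (ht' : ∀ x ∈ W, G.Adj p x → ¬ G.Adj x t) :
    s = t := by
  obtain ⟨q, hq, r, hr, hpq, hqr, hrp⟩ := hp
  have hqs : q ≠ s := fun h => hs' r hr hrp.symm (h ▸ hqr.symm)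
  have hrs : r ≠ s := fun h => hs' q hq hpq (h ▸ hqr)
  have hqt : q ≠ t := fun h => ht' r hr hrp.symm (h ▸ hqr.symm)
  have hrt : r ≠ t := fun h => ht' q hq hpq (h ▸ hqr)
  have htN : t ∈ nbrs G W p := mem_nbrs.2 ⟨ht, hpt⟩
  rw [nbrs_eq_triple hd hq hr hs hpq hrp.symm hps hqr.ne hrs hqs] at htN
  simp only [Finset.mem_insert, Finset.mem_singleton, hqt.symm, hrt.symm, false_or] at htN
  exact htN.symm

lemma cross_seven {a b c u x y z : V} (hab : G.Adj a b) (hbc : G.Adj b c) (hca : G.Adj c a)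
    (hau : G.Adj a u) (hux : G.Adj u x) (hxy : G.Adj x y) (hyu : G.Adj y u) (hxz : G.Adj x z)
    (hbu : ¬ G.Adj b u) (hcu : ¬ G.Adj c u) (hax : ¬ G.Adj a x) (hay : ¬ G.Adj a y)
    (haz : ¬ G.Adj a z) (hbx : ¬ G.Adj b x) (hby : ¬ G.Adj b y) (hbz : ¬ G.Adj b z)
    (hcx : ¬ G.Adj c x) (hcy : ¬ G.Adj c y) (hcz : ¬ G.Adj c z) (huz : ¬ G.Adj u z)
    (hyz : ¬ G.Adj y z) :
    ({a, b, c, u, x, y, z} : Finset V).card = 7 ∧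
      cross G {a, b, c, u, x, y, z} {a, b, c, u, x, y, z} = 16 := by
  have h1 : a ≠ x := by rintro rfl; exact hbx hab.symm
  have h2 : a ≠ y := by rintro rfl; exact hby hab.symm
  have h3 : a ≠ z := by rintro rfl; exact hax hxz.symm
  have h4 : b ≠ u := by rintro rfl; exact hcu hbc.symm
  have h5 : b ≠ x := by rintro rfl; exact hax hab
  have h6 : b ≠ y := by rintro rfl; exact hay hab
  have h7 : b ≠ z := by rintro rfl; exact haz hab
  have h8 : c ≠ u := by rintro rfl; exact hbu hbc
  have h9 : c ≠ x := by rintro rfl; exact hax hca.symm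
  have h10 : c ≠ y := by rintro rfl; exact hay hca.symm
  have h11 : c ≠ z := by rintro rfl; exact haz hca.symm
  have h12 : u ≠ z := by rintro rfl; exact haz hau
  have h13 : y ≠ z := by rintro rfl; exact huz hyu.symm
  constructor
  · simp [*, hab.ne, hbc.ne, hca.ne', hau.ne, hux.ne, hxy.ne, hyu.ne', hxz.ne]
  · have hs : ∀ {p q : V}, ¬ G.Adj p q → ¬ G.Adj q p := fun h h' => h h'.symm
    simp [cross, degIn, nbrs, Finset.filter_insert, Finset.filter_singleton, h1, h2, h3, h4, h5, h6,
      h7, h8, h9, h10, h11, h12, h13, hab.ne, hbc.ne, hca.ne', hau.ne, hux.ne, hxy.ne, hyu.ne',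
      hxz.ne, hab, hbc, hca, hau, hux, hxy, hyu, hxz, hab.symm, hbc.symm, hca.symm, hau.symm,
      hux.symm, hxy.symm, hyu.symm, hxz.symm, hbu, hcu, hax, hay, haz, hbx, hby, hbz, hcx, hcy, hcz,
      huz, hyz, hs hbu, hs hcu, hs hax, hs hay, hs haz, hs hbx, hs hby, hs hbz, hs hcx, hs hcy,
      hs hcz, hs huz, hs hyz]

lemma not_cubic (hG : ¬ HasTriangleAdjC4 G) {W : Finset V}
    (hIH : ∀ U, U ⊂ W → HasLargeIndep G U) (hW : ¬ HasLargeIndep G W)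
    (h3 : ∀ x ∈ W, 3 ≤ degIn G W x) {a : V} (ha : a ∈ W) : degIn G W a ≠ 3 := by
  intro hda
  have htri : ∀ v ∈ W, degIn G W v = 3 → InTriangle G W v :=
    fun v hv hd => inTriangle_of_cubic hG hIH hW h3 hv hd
  have hcub : ∀ v ∈ W, degIn G W v = 3 → ∀ x ∈ W, G.Adj v x → degIn G W x = 3 :=
    fun v hv hd x hx hvx =>
      nbrs_cubic_of_inTriangle hG hIH hW h3 hv hd (htri v hv hd) x (mem_nbrs.2 ⟨hx, hvx⟩)
  obtain ⟨b, hb, c, hc, hab, hbc, hca⟩ := htri a ha hda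
  obtain ⟨u, hu, hau, hbu', hcu', hNa⟩ := exists_third_nbr hda hb hc hab hca.symm hbc.ne
  have hdb := hcub a ha hda b hb hab
  have hdc := hcub a ha hda c hc hca.symm
  have hdu := hcub a ha hda u hu hau
  obtain ⟨x, hx, y, hy, hux, hxy, hyu⟩ := htri u hu hdu
  have hdx := hcub u hu hdu x hx hux
  have hdy := hcub u hu hdu y hy hyu.symm
  obtain ⟨z, hz, hxz, huz', hyz', hNx⟩ :=
    exists_third_nbr hdx hu hy hux.symm hxy hyu.ne'
  have hdz := hcub x hx hdx z hz hxz
  have hau' := no_common_nbr_of_cubic hG hda hb hc hu hab hbc hca hau hbu' hcu'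
  have hxz' := no_common_nbr_of_cubic hG hdx hu hy hz hux.symm hyu.symm hxy.symm hxz huz' hyz'
  have hbu : ¬ G.Adj b u := hau' b hb hab
  have hcu : ¬ G.Adj c u := hau' c hc hca.symm
  have huz : ¬ G.Adj u z := hxz' u hu hux.symm
  have hyz : ¬ G.Adj y z := hxz' y hy hxy
  have hax : ¬ G.Adj a x := fun h => hau' x hx h hux.symm
  have hay : ¬ G.Adj a y := fun h => hau' y hy h hyu
  have hxa : x ≠ a := fun h => hau' y hy (h ▸ hxy) hyu
  have hya : y ≠ a := fun h => hau' x hx (h ▸ hxy.symm) hux.symm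
  have hbx : ¬ G.Adj b x := fun h =>
    hG ⟨a, b, c, x, u, hab, hbc, hca, h, hux.symm, hau.symm, hxa.symm, hbu'⟩
  have hby : ¬ G.Adj b y := fun h =>
    hG ⟨a, b, c, y, u, hab, hbc, hca, h, hyu, hau.symm, hya.symm, hbu'⟩
  have hcx : ¬ G.Adj c x := fun h =>
    hG ⟨a, c, b, x, u, hca.symm, hbc.symm, hab.symm, h, hux.symm, hau.symm, hxa.symm, hcu'⟩
  have hcy : ¬ G.Adj c y := fun h =>
    hG ⟨a, c, b, y, u, hca.symm, hbc.symm, hab.symm, h, hyu, hau.symm, hya.symm, hcu'⟩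
  have hza : a ≠ z := by rintro rfl; exact hax hxz.symm
  have hbz' : b ≠ z := by rintro rfl; exact hbx hxz.symm
  have hcz' : c ≠ z := by rintro rfl; exact hcx hxz.symm
  have hsymm : ∀ {p q : V}, (∀ t ∈ W, G.Adj p t → ¬ G.Adj t q) →
      ∀ t ∈ W, G.Adj q t → ¬ G.Adj t p := fun h t ht h1 h2 => h t ht h2.symm h1.symm
  have hbz : ¬ G.Adj b z := fun h => by
    have h1 := no_common_nbr_of_cubic hG hdb ha hc hz hab.symm hca.symm hbc.symm h hza hcz'
    have := eq_of_no_common_nbr hdz (htri z hz hdz) hb hx h.symm hxz.symm (hsymm h1) (hsymm hxz')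
    exact hax (this ▸ hab)
  have hcz : ¬ G.Adj c z := fun h => by
    have h1 := no_common_nbr_of_cubic hG hdc ha hb hz hca hab hbc h hza hbz'
    have := eq_of_no_common_nbr hdz (htri z hz hdz) hc hx h.symm hxz.symm (hsymm h1) (hsymm hxz')
    exact hax (this ▸ hca.symm)
  have haz : ¬ G.Adj a z := fun h => by
    have : z ∈ nbrs G W a := mem_nbrs.2 ⟨hz, h⟩
    simp [hNa, hbz'.symm, hcz'.symm, huz'.symm] at this
  obtain ⟨hcard, hcross⟩ := cross_seven hab hbc hca hau hux hxy hyu hxz hbu hcu hax hay haz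
    hbx hby hbz hcx hcy hcz huz hyz
  have hSW : ({a, b, c, u, x, y, z} : Finset V) ⊆ W := by
    simp [Finset.insert_subset_iff, *]
  have hS : ∀ v ∈ ({a, b, c, u, x, y, z} : Finset V), degIn G W v = 3 := by
    simp [hda, hdb, hdc, hdu, hdx, hdy, hdz]
  have hsum := cross_add_cross_sdiff (G := G) hSW
  rw [Finset.sum_const_nat hS, hcard, hcross] at hsum
  have hn := card_newComps_le_of_degree hSW fun v hv _ => h3 v hv
  have hcost := cost_sdiff_le (G := G) W {a, b, c, u, x, y, z}
  refine hW (hasLargeIndep_of_sdiff (J := {a, x}) hSW (hIH _ ?_) ?_ ?_ ?_ ?_)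
  · exact Finset.sdiff_ssubset hSW ⟨a, by simp⟩
  · simp [Finset.insert_subset_iff]
  · simp [IsIndepSet, hax, G.adj_comm x a]
  · intro p hp q hq hpq
    simp only [Finset.mem_insert, Finset.mem_singleton] at hp
    have hqN : q ∈ nbrs G W p := mem_nbrs.2 ⟨hq, hpq⟩
    rcases hp with rfl | rfl
    · rw [hNa, Finset.mem_insert, Finset.mem_insert, Finset.mem_singleton] at hqN
      rcases hqN with rfl | rfl | rfl <;> simp
    · rw [hNx, Finset.mem_insert, Finset.mem_insert, Finset.mem_singleton] at hqN
      rcases hqN with rfl | rfl | rfl <;> simp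
  · rw [hcard, hcross, Finset.card_pair hxa.symm]
    omega

end SevenVertices

section Conclusion

variable {V : Type} [DecidableEq V] {G : SimpleGraph V} [DecidableRel G.Adj]

theorem hasLargeIndep (hG : ¬ HasTriangleAdjC4 G) (W : Finset V) : HasLargeIndep G W := by
  induction W using Finset.strongInduction with
  | H W hIH =>
  by_contra hW
  have hne : W.Nonempty := by
    rw [Finset.nonempty_iff_ne_empty]
    rintro rfl
    exact hW ⟨∅, by simp, by simp [IsIndepSet], by simp⟩
  have h1 : ∀ v ∈ W, 2 ≤ degIn G W v := fun v hv => by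
    by_contra h
    exact hW (hasLargeIndep_of_degIn_le_one hIH hv (by omega))
  have h2 : ∀ v ∈ W, InTriangle G W v → 3 ≤ degIn G W v := fun v hv hvt => by
    by_contra h
    exact hW (hasLargeIndep_of_degIn_eq_two_triangle hIH hv (by have := h1 v hv; omega) hvt)
  have h3 : ∀ v ∈ W, 3 ≤ degIn G W v := fun v hv => by
    by_contra h
    have hd : degIn G W v = 2 := by have := h1 v hv; omega
    exact hW (hasLargeIndep_of_degIn_eq_two hIH hv hd (fun hvt => h (h2 v hv hvt)) h1 h2)
  have h4 : ∀ v ∈ W, 4 ≤ degIn G W v := fun v hv => by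
    have := not_cubic hG hIH hW h3 hv
    have := h3 v hv
    omega
  obtain ⟨v, hv, hmin⟩ := W.exists_min_image (degIn G W) hne
  exact hW (hasLargeIndep_of_four_le hG hIH hv (h4 v hv) hmin)

end Conclusion

section Ratio

variable {V : Type} [Fintype V] {G : SimpleGraph V}

/-- A component of `G[V]` isomorphic to `H` is a connected component of `G` isomorphic to `H`. -/
lemma IsCompOf.exists_iso {k : ℕ} {H : SimpleGraph (Fin (k + 1))} (hH : H.Preconnected)
    {C : Finset V} (hC : IsCompOf G H Finset.univ C) :
    ∃ c : G.ConnectedComponent, Nonempty (SimpleGraph.induce c.supp G ≃g H) := by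
  obtain ⟨-, ⟨φ, rfl⟩, hcl⟩ := hC
  refine ⟨G.connectedComponentMk (φ 0), ⟨SimpleGraph.Iso.symm ⟨Equiv.ofBijective
    (fun i => ⟨φ i, SimpleGraph.ConnectedComponent.sound ((hH i 0).map φ.toHom)⟩)
    ⟨fun i j hij => φ.injective (congrArg Subtype.val hij), ?_⟩, φ.map_rel_iff⟩⟩⟩
  rintro ⟨x, hx⟩
  obtain ⟨p⟩ := (SimpleGraph.ConnectedComponent.exact hx).symm
  have key : ∀ u v : V, G.Walk u v → (∃ i, φ i = u) → ∃ i, φ i = v := by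
    intro u v p
    induction p with
    | nil => exact id
    | @cons u v w huv p ih =>
      rintro ⟨i, rfl⟩
      obtain ⟨j, -, hj⟩ := Finset.mem_map.1
        (hcl _ (Finset.mem_map_of_mem φ.toEmbedding (Finset.mem_univ i)) v (Finset.mem_univ v) huv)
      exact ih ⟨j, hj⟩
  obtain ⟨i, hi⟩ := key _ _ p ⟨0, rfl⟩
  exact ⟨i, Subtype.ext hi⟩

lemma cost_univ_eq_zero (hG : lambda G = 0) : cost G Finset.univ = 0 := by
  have hnot : ∀ c, ¬ IsDifficult G c := by
    rcases Nat.card_eq_zero.1 hG with h | h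
    · exact fun c hc => h.elim ⟨c, hc⟩
    · exact absurd h (not_infinite_iff_finite.2 inferInstance)
  have h3 : comps G (⊤ : SimpleGraph (Fin 3)) Finset.univ = ∅ :=
    Finset.eq_empty_of_forall_notMem fun C hC =>
      have ⟨c, hc⟩ := (mem_comps.1 hC).exists_iso top_preconnected
      hnot c (Or.inl hc)
  have h6 : comps G chainGraph Finset.univ = ∅ :=
    Finset.eq_empty_of_forall_notMem fun C hC =>
      have ⟨c, hc⟩ := (mem_comps.1 hC).exists_iso chainGraph_preconnected
      hnot c (Or.inr hc)
  simp [cost, h3, h6]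

lemma cross_univ [DecidableEq V] [DecidableRel G.Adj] :
    cross G Finset.univ Finset.univ = 2 * numEdges G := by
  rw [numEdges, Nat.card_eq_fintype_card, ← SimpleGraph.edgeFinset_card,
    ← G.sum_degrees_eq_twice_card_edges]
  refine Finset.sum_congr rfl fun x _ => ?_
  rw [degIn, nbrs, ← G.neighborFinset_eq_filter, G.card_neighborFinset_eq_degree]

lemma IsIndepSet.card_le_indepNum {I : Finset V} (hI : IsIndepSet G I) :
    I.card ≤ indepNum G := by
  refine le_csSup ⟨Fintype.card V, ?_⟩ ⟨I, hI, rfl⟩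
  rintro n ⟨s, -, rfl⟩
  exact s.card_le_univ

end Ratio

/-- Independence ratio at most 4 - 1/30 for graphs with no triangle adjacent to a
4-cycle, no difficult components, and edge bound |E| ≤ (15/7)(|V| - 2). -/
theorem indep_ratio_no_triangle_adj_C4
    {V : Type} [Fintype V] (G : SimpleGraph V)
    (hG : ¬ HasTriangleAdjC4 G) (hlam : lambda G = 0)
    (hE : (numEdges G : ℝ) ≤ (15 / 7) * ((Nat.card V : ℝ) - 2)) :
    (indepNum G : ℝ) ≥ (30 / 119) * Nat.card V := by
  classical
  obtain ⟨I, -, hI, h⟩ := hasLargeIndep hG Finset.univ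
  rw [cost_univ_eq_zero hlam, cross_univ, Finset.card_univ, ← Nat.card_eq_fintype_card] at h
  have hcard : (I.card : ℝ) ≤ indepNum G := mod_cast hI.card_le_indepNum
  have h : (30 * Nat.card V : ℝ) ≤ 68 * I.card + 3 * (2 * numEdges G) := mod_cast h
  linarith

end Paper
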